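/- Let E|k be a finite tamely ramified extension of non-Archimedean local fields. Then μ_tame(E|k) is non-empty, and it is an equivalence class of the relation ∼_{E|k}: for every x ∈ μ_tame(E|k) and every y ∈ μ_{q_E−1}(E), one has y ∈ μ_tame(E|k) if and only if (x y^{−1})^{(q_E−1)/ẽ} = 1. -/

import Mathlib

noncomputable section

/-- Axioms expressing that `ν : K → EReal` is the additive valuation of a
non-Archimedean local (skew) field structure on `K`, normalized relatively to a base
field with valuation group `ℤ`, so that the value group of `K` is `(1/e)ℤ`; `K` is
complete and its residue field has exactly `q` elements (encoded by a complete finite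
set of residue representatives). -/
structure IsLocalValuation (K : Type*) [DivisionRing K] (ν : K → EReal) (e q : ℕ) : Prop where
  e_pos : 0 < e
  one_lt_q : 1 < q
  eq_top_iff : ∀ x : K, ν x = ⊤ ↔ x = 0
  map_mul : ∀ x y : K, ν (x * y) = ν x + ν y
  min_le_add : ∀ x y : K, min (ν x) (ν y) ≤ ν (x + y)
  values : ∀ x : K, x ≠ 0 → ∃ m : ℤ, ν x = ((m / e : ℝ) : EReal)
  exists_uniformizer : ∃ π : K, ν π = (((e : ℝ)⁻¹ : ℝ) : EReal)
  complete : ∀ x : ℕ → K,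
      (∀ M : ℝ, ∃ N : ℕ, ∀ m ≥ N, ∀ n ≥ N, (M : EReal) ≤ ν (x m - x n)) →
      ∃ l : K, ∀ M : ℝ, ∃ N : ℕ, ∀ n ≥ N, (M : EReal) ≤ ν (x n - l)
  residue : ∃ s : Finset K, s.card = q ∧ (∀ y ∈ s, 0 ≤ ν y) ∧
      ∀ x : K, 0 ≤ ν x → ∃! y, y ∈ s ∧ 0 < ν (x - y)

namespace IsLocalValuation

variable {K : Type*} [Field K] {ν : K → EReal} {e q : ℕ}

lemma map_zero (h : IsLocalValuation K ν e q) : ν 0 = ⊤ := (h.eq_top_iff 0).2 rfl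

lemma exists_real (h : IsLocalValuation K ν e q) {x : K} (hx : x ≠ 0) :
    ∃ r : ℝ, ν x = (r : EReal) :=
  let ⟨_, hm⟩ := h.values x hx
  ⟨_, hm⟩

lemma map_one (h : IsLocalValuation K ν e q) : ν 1 = 0 := by
  obtain ⟨r, hr⟩ := h.exists_real (one_ne_zero (α := K))
  have := h.map_mul 1 1
  rw [mul_one, hr, ← EReal.coe_add, EReal.coe_eq_coe_iff] at this
  rw [hr, ← EReal.coe_zero, EReal.coe_eq_coe_iff]
  linarith

lemma map_neg_one (h : IsLocalValuation K ν e q) : ν (-1) = 0 := by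
  obtain ⟨r, hr⟩ := h.exists_real (neg_ne_zero.2 (one_ne_zero (α := K)))
  have := h.map_mul (-1) (-1)
  rw [neg_mul_neg, mul_one, h.map_one, hr, ← EReal.coe_add, ← EReal.coe_zero,
    EReal.coe_eq_coe_iff] at this
  rw [hr, ← EReal.coe_zero, EReal.coe_eq_coe_iff]
  linarith

lemma map_neg (h : IsLocalValuation K ν e q) (x : K) : ν (-x) = ν x := by
  rw [← neg_one_mul, h.map_mul, h.map_neg_one, zero_add]

lemma map_sub_comm (h : IsLocalValuation K ν e q) (x y : K) : ν (x - y) = ν (y - x) := by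
  rw [← neg_sub, h.map_neg]

lemma le_map_sub (h : IsLocalValuation K ν e q) {c : EReal} {x y z : K}
    (hxy : c ≤ ν (x - y)) (hyz : c ≤ ν (y - z)) : c ≤ ν (x - z) := by
  rw [← sub_add_sub_cancel x y z]
  exact (le_min hxy hyz).trans (h.min_le_add _ _)

lemma ne_zero_of_eq_coe (h : IsLocalValuation K ν e q) {x : K} {r : ℝ} (hx : ν x = r) :
    x ≠ 0 := by
  rintro rfl
  rw [h.map_zero] at hx
  exact EReal.coe_ne_top r hx.symm

lemma map_inv (h : IsLocalValuation K ν e q) {x : K} {r : ℝ} (hx : ν x = r) :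
    ν x⁻¹ = ((-r : ℝ) : EReal) := by
  have h0 := h.ne_zero_of_eq_coe hx
  obtain ⟨s, hs⟩ := h.exists_real (inv_ne_zero h0)
  have := h.map_mul x x⁻¹
  rw [mul_inv_cancel₀ h0, h.map_one, hx, hs, ← EReal.coe_add, ← EReal.coe_zero,
    EReal.coe_eq_coe_iff] at this
  rw [hs, EReal.coe_eq_coe_iff]
  linarith

lemma map_pow (h : IsLocalValuation K ν e q) {x : K} {r : ℝ} (hx : ν x = r) (n : ℕ) :
    ν (x ^ n) = ((n * r : ℝ) : EReal) := by
  induction n with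
  | zero => simp [h.map_one]
  | succ n ih =>
    rw [pow_succ, h.map_mul, ih, hx, ← EReal.coe_add]
    congr 1
    push_cast
    ring

lemma map_eq_zero_of_pow_eq_one (h : IsLocalValuation K ν e q) {x : K} {n : ℕ} (hn : n ≠ 0)
    (hx : x ^ n = 1) : ν x = 0 := by
  obtain ⟨r, hr⟩ := h.exists_real (x := x) (by rintro rfl; simp [hn] at hx)
  have := h.map_pow hr n
  rw [hx, h.map_one, ← EReal.coe_zero, EReal.coe_eq_coe_iff] at this
  have hn' : (n : ℝ) ≠ 0 := by exact_mod_cast hn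
  rw [hr, ← EReal.coe_zero, EReal.coe_eq_coe_iff]
  simpa [hn'] using this.symm

lemma inv_le_of_pos (h : IsLocalValuation K ν e q) {x : K} (hx : 0 < ν x) :
    (((e : ℝ)⁻¹ : ℝ) : EReal) ≤ ν x := by
  by_cases h0 : x = 0
  · simp [h0, h.map_zero]
  obtain ⟨m, hm⟩ := h.values x h0
  have he : (0 : ℝ) < e := by exact_mod_cast h.e_pos
  rw [hm, EReal.coe_le_coe_iff]
  rw [hm, ← EReal.coe_zero, EReal.coe_lt_coe_iff, div_pos_iff_of_pos_right he] at hx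
  have : (1 : ℝ) ≤ m := by exact_mod_cast hx
  rw [inv_eq_one_div]
  gcongr

/-- The valuation ring of a local valuation. -/
def integers (h : IsLocalValuation K ν e q) : Subring K where
  carrier := {x | 0 ≤ ν x}
  mul_mem' {x y} hx hy := by
    simp only [Set.mem_ofPred_eq] at *
    rw [h.map_mul]
    exact add_nonneg hx hy
  one_mem' := h.map_one.ge
  add_mem' {x y} hx hy := (le_min hx hy).trans (h.min_le_add x y)
  zero_mem' := by simp [h.map_zero]
  neg_mem' {x} hx := by simpa [h.map_neg] using hx

/-- The maximal ideal of the valuation ring of a local valuation. -/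
def maxIdeal (h : IsLocalValuation K ν e q) : Ideal h.integers where
  carrier := {x | 0 < ν (x : K)}
  add_mem' {x y} hx hy := (lt_min hx hy).trans_le (h.min_le_add x y)
  zero_mem' := by simp [h.map_zero]
  smul_mem' c x hx := by
    simp only [Set.mem_ofPred_eq, smul_eq_mul, Subring.coe_mul] at *
    rw [h.map_mul]
    exact hx.trans_le (le_add_of_nonneg_left c.2)

lemma mem_maxIdeal (h : IsLocalValuation K ν e q) {x : h.integers} :
    x ∈ h.maxIdeal ↔ 0 < ν (x : K) := Iff.rfl

lemma mem_maxIdeal_pow (h : IsLocalValuation K ν e q) {x : h.integers} (n : ℕ) :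
    x ∈ h.maxIdeal ^ n ↔ ((n * (e : ℝ)⁻¹ : ℝ) : EReal) ≤ ν (x : K) := by
  obtain ⟨π, hπ⟩ := h.exists_uniformizer
  have he : (0 : ℝ) < e := by exact_mod_cast h.e_pos
  have hπ0 := h.ne_zero_of_eq_coe hπ
  have hdiv : ∀ (j : ℕ) (y : h.integers), ((j * (e : ℝ)⁻¹ : ℝ) : EReal) ≤ ν (y : K) →
      0 ≤ ν ((y : K) * (π ^ j)⁻¹) := by
    intro j y hy
    by_cases hy0 : (y : K) = 0
    · simp [hy0, h.map_zero]
    obtain ⟨r, hr⟩ := h.exists_real hy0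
    rw [h.map_mul, h.map_inv (h.map_pow hπ j), hr, ← EReal.coe_add, ← EReal.coe_zero,
      EReal.coe_le_coe_iff]
    rw [hr, EReal.coe_le_coe_iff] at hy
    linarith
  let ϖ : h.integers := ⟨π, by
    change 0 ≤ ν π
    rw [hπ, ← EReal.coe_zero, EReal.coe_le_coe_iff]
    positivity⟩
  have hϖ : ϖ ∈ h.maxIdeal := by
    change 0 < ν π
    rw [hπ, ← EReal.coe_zero, EReal.coe_lt_coe_iff]
    positivity
  have hspan : h.maxIdeal = Ideal.span {ϖ} := by
    apply le_antisymm
    · intro y hy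
      rw [Ideal.mem_span_singleton]
      refine ⟨⟨_, hdiv 1 y (by simpa using h.inv_le_of_pos hy)⟩, Subtype.ext ?_⟩
      simp only [Subring.coe_mul, ϖ]
      field_simp
    · rwa [Ideal.span_singleton_le_iff_mem]
  rw [hspan, Ideal.span_singleton_pow, Ideal.mem_span_singleton]
  constructor
  · rintro ⟨c, rfl⟩
    simp only [Subring.coe_mul, Subring.coe_pow, h.map_mul, ϖ, h.map_pow hπ]
    exact le_add_of_nonneg_right c.2
  · intro hx
    refine ⟨⟨_, hdiv n x hx⟩, Subtype.ext ?_⟩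
    simp only [Subring.coe_mul, Subring.coe_pow, ϖ]
    field_simp

lemma isAdicComplete (h : IsLocalValuation K ν e q) :
    IsAdicComplete h.maxIdeal h.integers where
  haus' x hx := by
    by_contra h0
    have h0' : (x : K) ≠ 0 := fun hh => h0 (Subtype.ext hh)
    obtain ⟨r, hr⟩ := h.exists_real h0'
    have he : (0 : ℝ) < e := by exact_mod_cast h.e_pos
    obtain ⟨n, hn⟩ := exists_nat_gt (r * e)
    have := hx n
    rw [SModEq.zero, smul_eq_mul, Ideal.mul_top, h.mem_maxIdeal_pow, hr,
      EReal.coe_le_coe_iff, ← div_eq_mul_inv, div_le_iff₀ he] at this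
    linarith
  prec' f hf := by
    simp only [SModEq.sub_mem, smul_eq_mul, Ideal.mul_top, h.mem_maxIdeal_pow,
      AddSubgroupClass.coe_sub] at hf ⊢
    have he : (0 : ℝ) < e := by exact_mod_cast h.e_pos
    obtain ⟨l, hl⟩ := h.complete (fun n => (f n : K)) (by
      intro M
      obtain ⟨N, hN⟩ := exists_nat_gt (M * e)
      refine ⟨N, fun m hm n hn => ?_⟩
      have hM : (M : EReal) ≤ ((N * (e : ℝ)⁻¹ : ℝ) : EReal) := by
        rw [EReal.coe_le_coe_iff, ← div_eq_mul_inv, le_div_iff₀ he]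
        exact hN.le
      refine hM.trans (h.le_map_sub (y := (f N : K)) ?_ (hf hn))
      rw [h.map_sub_comm]
      exact hf hm)
    have key : ∀ n : ℕ, ((n * (e : ℝ)⁻¹ : ℝ) : EReal) ≤ ν ((f n : K) - l) := by
      intro n
      obtain ⟨N, hN⟩ := hl (n * (e : ℝ)⁻¹)
      exact h.le_map_sub (hf (le_max_left n N)) (hN _ (le_max_right n N))
    have hl0 : 0 ≤ ν l := by
      have h1 := key 0
      rw [h.map_sub_comm] at h1
      simpa using h.le_map_sub (z := (0 : K)) (c := 0) (by simpa using h1)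
        (by rw [sub_zero]; exact (f 0).2)
    exact ⟨⟨l, hl0⟩, key⟩

lemma maxIdeal_isMaximal (h : IsLocalValuation K ν e q) : h.maxIdeal.IsMaximal := by
  rw [Ideal.isMaximal_iff]
  refine ⟨by rw [mem_maxIdeal]; simp [h.map_one], fun J x _ hx hxJ => ?_⟩
  have h0 : ν (x : K) = 0 := le_antisymm (not_lt.1 hx) x.2
  have h1 := h.map_inv (r := 0) (by simpa using h0)
  have hx0 := h.ne_zero_of_eq_coe (r := 0) (by simpa using h0)
  have : (1 : h.integers) = ⟨(x : K)⁻¹, by change 0 ≤ ν _; simp [h1]⟩ * x :=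
    Subtype.ext (by simp [hx0])
  rw [this]
  exact J.mul_mem_left _ hxJ

lemma card_residue (h : IsLocalValuation K ν e q) : Nat.card (h.integers ⧸ h.maxIdeal) = q := by
  obtain ⟨s, hs, hs0, hsu⟩ := h.residue
  refine Eq.trans ?_ ((Nat.card_eq_finsetCard s).trans hs)
  refine Eq.symm (Nat.card_congr (Equiv.ofBijective
    (fun y : s => Ideal.Quotient.mk h.maxIdeal ⟨y, hs0 y y.2⟩) ⟨fun y z hyz => ?_, fun x => ?_⟩))
  · have hyz' : 0 < ν ((y : K) - z) := Ideal.Quotient.eq.1 hyz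
    exact Subtype.ext ((hsu y (hs0 y y.2)).unique ⟨y.2, by simp [h.map_zero]⟩ ⟨z.2, hyz'⟩)
  · obtain ⟨x, rfl⟩ := Ideal.Quotient.mk_surjective x
    obtain ⟨y, ⟨hy, hxy⟩, -⟩ := hsu x x.2
    refine ⟨⟨y, hy⟩, ?_⟩
    rw [eq_comm]
    exact Ideal.Quotient.eq.2 hxy

lemma isUnit_natCast_residue (h : IsLocalValuation K ν e q) {n : ℕ} (hn : n.Coprime q) :
    IsUnit (n : h.integers ⧸ h.maxIdeal) := by
  have : (q : h.integers ⧸ h.maxIdeal) = 0 := by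
    have : Finite (h.integers ⧸ h.maxIdeal) :=
      Nat.finite_of_card_ne_zero (by have := h.one_lt_q; rw [h.card_residue]; omega)
    let := Fintype.ofFinite (h.integers ⧸ h.maxIdeal)
    have hcard := Nat.cast_card_eq_zero (h.integers ⧸ h.maxIdeal)
    rwa [← Nat.card_eq_fintype_card, h.card_residue] at hcard
  obtain ⟨a, b, hab⟩ := (Nat.isCoprime_iff_coprime.2 hn)
  have hab' := congrArg (Int.cast : ℤ → h.integers ⧸ h.maxIdeal) hab
  push_cast at hab'
  rw [this, mul_zero, add_zero] at hab'
  exact IsUnit.of_mul_eq_one_right _ hab'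

/-- Hensel's lemma for `X ^ n - a` with `n` prime to the residue characteristic. -/
lemma exists_pow_eq (h : IsLocalValuation K ν e q) {n : ℕ} (hn0 : n ≠ 0) (hn : n.Coprime q)
    {u a : K} (hu : ν u = 0) (ha : 0 ≤ ν a) (hua : 0 < ν (u ^ n - a)) :
    ∃ w : K, w ^ n = a ∧ 0 < ν (w - u) := by
  have := h.isAdicComplete
  have := h.maxIdeal_isMaximal
  let := Ideal.Quotient.field h.maxIdeal
  let u' : h.integers := ⟨u, hu.ge⟩
  let a' : h.integers := ⟨a, ha⟩
  have hu' : Ideal.Quotient.mk h.maxIdeal u' ≠ 0 := by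
    rw [Ne, Ideal.Quotient.eq_zero_iff_mem, mem_maxIdeal]
    exact fun hlt => hlt.ne' hu
  obtain ⟨w, hw, hwu⟩ := HenselianRing.is_henselian (I := h.maxIdeal)
    (Polynomial.X ^ n - Polynomial.C a') (Polynomial.monic_X_pow_sub_C a' hn0) u'
    (by simpa [mem_maxIdeal] using hua)
    (by
      simp only [Polynomial.derivative_sub, Polynomial.derivative_X_pow, Polynomial.derivative_C,
        sub_zero, Polynomial.eval_mul, Polynomial.eval_pow, Polynomial.eval_X,
        Polynomial.eval_natCast, _root_.map_mul, _root_.map_pow, map_natCast]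
      exact (h.isUnit_natCast_residue hn).mul ((isUnit_iff_ne_zero.2 hu').pow _))
  refine ⟨w, ?_, hwu⟩
  have : w ^ n - a' = 0 := by simpa [Polynomial.IsRoot] using hw
  simpa [sub_eq_zero] using congrArg Subtype.val this

lemma map_eq_zero_of_sub_one (h : IsLocalValuation K ν e q) {v : K} (hv : 0 < ν (v - 1)) :
    ν v = 0 := by
  have h1 : 0 ≤ ν v := by
    simpa using h.le_map_sub (z := (0 : K)) hv.le (by simp [h.map_one])
  refine le_antisymm (not_lt.1 fun h2 => ?_) h1
  have := (lt_min hv h2).trans_le (by simpa [h.map_sub_comm] using h.min_le_add (1 - v) v)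
  simp [h.map_one] at this

lemma sub_one_mul (h : IsLocalValuation K ν e q) {v w : K} (hv : 0 < ν (v - 1))
    (hw : 0 < ν (w - 1)) : 0 < ν (v * w - 1) := by
  rw [show v * w - 1 = (v - 1) * w + (w - 1) by ring]
  refine (lt_min ?_ hw).trans_le (h.min_le_add _ _)
  rwa [h.map_mul, h.map_eq_zero_of_sub_one hw, add_zero]

lemma sub_one_pow (h : IsLocalValuation K ν e q) {v : K} (hv : 0 < ν (v - 1)) (n : ℕ) :
    0 < ν (v ^ n - 1) := by
  induction n with
  | zero => simp [h.map_zero]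
  | succ n ih => rw [pow_succ]; exact h.sub_one_mul ih hv

lemma map_inv_of_eq_zero (h : IsLocalValuation K ν e q) {v : K} (hv : ν v = 0) :
    ν v⁻¹ = 0 := by
  simpa using h.map_inv (r := 0) (by simpa using hv)

lemma ne_zero_of_map_eq_zero (h : IsLocalValuation K ν e q) {v : K} (hv : ν v = 0) :
    v ≠ 0 := h.ne_zero_of_eq_coe (r := 0) (by simpa using hv)

lemma sub_one_inv (h : IsLocalValuation K ν e q) {v : K} (hv : 0 < ν (v - 1)) :
    0 < ν (v⁻¹ - 1) := by
  have h0 := h.map_eq_zero_of_sub_one hv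
  have hne := h.ne_zero_of_map_eq_zero h0
  rw [show v⁻¹ - 1 = (1 - v) * v⁻¹ by field_simp, h.map_mul, h.map_inv_of_eq_zero h0,
    add_zero, h.map_sub_comm]
  exact hv

/-- The Teichmüller decomposition of units. -/
lemma exists_primitiveRoot (h : IsLocalValuation K ν e q) :
    ∃ ω : K, IsPrimitiveRoot ω (q - 1) ∧ (∀ i : ℕ, 0 < ν (ω ^ i - 1) → q - 1 ∣ i) ∧
      ∀ u : K, ν u = 0 → ∃ (i : ℕ) (v : K), u = ω ^ i * v ∧ 0 < ν (v - 1) := by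
  have hq := h.one_lt_q
  have := h.maxIdeal_isMaximal
  let := Ideal.Quotient.field h.maxIdeal
  have : Finite (h.integers ⧸ h.maxIdeal) :=
    Nat.finite_of_card_ne_zero (by rw [h.card_residue]; omega)
  obtain ⟨g, hg⟩ := IsCyclic.exists_generator (α := (h.integers ⧸ h.maxIdeal)ˣ)
  have hord : orderOf g = q - 1 := by
    rw [orderOf_eq_card_of_forall_mem_zpowers hg, Nat.card_units, h.card_residue]
  obtain ⟨u, hu⟩ := Ideal.Quotient.mk_surjective (g : h.integers ⧸ h.maxIdeal)
  have hu0 : ν (u : K) = 0 := by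
    refine le_antisymm (not_lt.1 fun hlt => g.ne_zero ?_) u.2
    rw [← hu]
    exact Ideal.Quotient.eq_zero_iff_mem.2 hlt
  have hu1 : 0 < ν ((u : K) ^ (q - 1) - 1) := by
    have : Ideal.Quotient.mk h.maxIdeal (u ^ (q - 1)) = Ideal.Quotient.mk h.maxIdeal 1 := by
      rw [_root_.map_pow, hu, ← Units.val_pow_eq_pow_val, ← hord, pow_orderOf_eq_one]
      simp
    exact Ideal.Quotient.eq.1 this
  have hcop : (q - 1).Coprime q := by
    have : (q - 1).Coprime (q - 1 + 1) := by simp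
    rwa [Nat.sub_add_cancel hq.le] at this
  obtain ⟨ω, hω, hωu⟩ := h.exists_pow_eq (by omega) hcop hu0 h.map_one.ge hu1
  have hω0 := h.map_eq_zero_of_pow_eq_one (by omega) hω
  let ω' : h.integers := ⟨ω, hω0.ge⟩
  have hω' : Ideal.Quotient.mk h.maxIdeal ω' = g := by
    rw [← hu]
    exact Ideal.Quotient.eq.2 hωu
  have hdvd : ∀ i : ℕ, 0 < ν (ω ^ i - 1) → q - 1 ∣ i := by
    intro i hi
    have : Ideal.Quotient.mk h.maxIdeal (ω' ^ i) = Ideal.Quotient.mk h.maxIdeal 1 :=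
      Ideal.Quotient.eq.2 hi
    rw [← hord, orderOf_dvd_iff_pow_eq_one]
    rw [_root_.map_pow, hω', _root_.map_one] at this
    exact Units.ext (by simpa using this)
  refine ⟨ω, ⟨hω, fun i hi => hdvd i (by simp [hi, h.map_zero])⟩, hdvd, fun z hz => ?_⟩
  let z' : h.integers := ⟨z, hz.ge⟩
  have hz' : Ideal.Quotient.mk h.maxIdeal z' ≠ 0 := by
    rw [Ne, Ideal.Quotient.eq_zero_iff_mem, mem_maxIdeal]
    exact fun hlt => hlt.ne' hz
  obtain ⟨i, hi⟩ := (mem_powers_iff_mem_zpowers.2 (hg (Units.mk0 _ hz')))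
  have hi' : Ideal.Quotient.mk h.maxIdeal z' = Ideal.Quotient.mk h.maxIdeal (ω' ^ i) := by
    rw [_root_.map_pow, hω']
    simpa using (congrArg Units.val hi).symm
  have hlt : 0 < ν (z - ω ^ i) := Ideal.Quotient.eq.1 hi'
  have hωi : ν (ω ^ i) = 0 := by simpa using h.map_pow (r := 0) (by simpa using hω0) i
  have hωi' := h.ne_zero_of_map_eq_zero hωi
  refine ⟨i, z * (ω ^ i)⁻¹, by field_simp, ?_⟩
  rw [show z * (ω ^ i)⁻¹ - 1 = (z - ω ^ i) * (ω ^ i)⁻¹ by field_simp, h.map_mul,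
    h.map_inv_of_eq_zero hωi, add_zero]
  exact hlt

end IsLocalValuation

/-- Let `E|k` be a finite tamely ramified extension of non-Archimedean
local fields (`e = e(E|k)` coprime to the residue characteristic `p`), `q = #κ_k`,
`qE = #κ_E = q^f`, and `ẽ = gcd((qE-1)/(q-1), e)`.  Then the set
`μ_tame(E|k) = {x ∈ μ_{qE-1}(E) | ∃ uniformizer π_E of E, π_E^e x⁻¹ ∈ o_k}` is
non-empty, and it is an equivalence class of the relation
`x ∼ y ↔ (x y⁻¹)^{(qE-1)/ẽ} = 1` on `μ_{qE-1}(E)`. -/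
theorem stmt_5
    {k E : Type*} [Field k] [Field E] [Algebra k E] [FiniteDimensional k E]
    (νk : k → EReal) (νE : E → EReal) (e f q qE : ℕ)
    (hk : IsLocalValuation k νk 1 q) (hE : IsLocalValuation E νE e qE)
    (hcompat : ∀ c : k, νE (algebraMap k E c) = νk c)
    (hdeg : Module.finrank k E = e * f) (hresdeg : qE = q ^ f)
    (p : ℕ) (hp : p.Prime) (hqp : ∃ n : ℕ, q = p ^ n)
    (htame : Nat.Coprime e p) :
    letI μtame : Set E := {x | x ^ (qE - 1) = 1 ∧
      ∃ πE : E, νE πE = (((e : ℝ)⁻¹ : ℝ) : EReal) ∧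
        ∃ y : k, 0 ≤ νk y ∧ algebraMap k E y = πE ^ e * x⁻¹}
    μtame.Nonempty ∧
      ∀ x ∈ μtame, ∀ y : E, y ^ (qE - 1) = 1 →
        (y ∈ μtame ↔ (x * y⁻¹) ^ ((qE - 1) / Nat.gcd ((qE - 1) / (q - 1)) e) = 1) := by
  have hqE1 := hE.one_lt_q
  have hq1 := hk.one_lt_q
  have he0 : e ≠ 0 := hE.e_pos.ne'
  have heR : (e : ℝ) ≠ 0 := by exact_mod_cast he0
  have hN0 : qE - 1 ≠ 0 := by omega
  have hcop : e.Coprime qE := by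
    obtain ⟨n, rfl⟩ := hqp
    rw [hresdeg]
    exact (htame.pow_right n).pow_right f
  have hqd : q - 1 ∣ qE - 1 := by
    rw [hresdeg]
    exact Nat.sub_one_dvd_pow_sub_one q f
  obtain ⟨ω, hω, hωd, hωu⟩ := hE.exists_primitiveRoot
  obtain ⟨θ, hθ, -, hθu⟩ := hk.exists_primitiveRoot
  have hθE : IsPrimitiveRoot (algebraMap k E θ) (q - 1) :=
    hθ.map_of_injective (algebraMap k E).injective
  constructor
  · obtain ⟨a, ha⟩ := hk.exists_uniformizer
    obtain ⟨π, hπ⟩ := hE.exists_uniformizer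
    have hπ0 := hE.ne_zero_of_eq_coe hπ
    have hu : νE (algebraMap k E a * (π ^ e)⁻¹) = 0 := by
      rw [hE.map_mul, hcompat, ha, hE.map_inv (hE.map_pow hπ e), ← EReal.coe_add,
        mul_inv_cancel₀ heR]
      simp
    obtain ⟨i, v, hiv, hv⟩ := hωu _ hu
    obtain ⟨w, hw, hw1⟩ := hE.exists_pow_eq he0 hcop (u := 1) (a := v) hE.map_one
      (hE.map_eq_zero_of_sub_one hv).ge (by rw [one_pow, hE.map_sub_comm]; exact hv)
    refine ⟨(ω ^ i)⁻¹, ?_, π * w, ?_, a, ?_, ?_⟩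
    · rw [inv_pow, ← pow_mul, mul_comm, pow_mul, hω.pow_eq_one, one_pow, inv_one]
    · rw [hE.map_mul, hπ, hE.map_eq_zero_of_sub_one hw1, add_zero]
    · simp [ha]
    · rw [mul_pow, hw, inv_inv, mul_assoc, mul_comm v, ← hiv]
      field_simp
  rintro x ⟨hx, π, hπ, a, ha, hax⟩ y hy
  have hx0 := hE.map_eq_zero_of_pow_eq_one hN0 hx
  have hy0 := hE.map_eq_zero_of_pow_eq_one hN0 hy
  have hxne := hE.ne_zero_of_map_eq_zero hx0
  have hyne := hE.ne_zero_of_map_eq_zero hy0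
  have hπ0 := hE.ne_zero_of_eq_coe hπ
  have hval : ∀ (z : E) (ϖ : E) (c : k), νE z = 0 → νE ϖ = (((e : ℝ)⁻¹ : ℝ) : EReal) →
      algebraMap k E c = ϖ ^ e * z⁻¹ → νk c = ((1 : ℝ) : EReal) := by
    intro z ϖ c hz hϖ hc
    rw [← hcompat, hc, hE.map_mul, hE.map_inv_of_eq_zero hz, hE.map_pow hϖ,
      mul_inv_cancel₀ heR, add_zero]
  have hνa := hval x π a hx0 hπ hax
  have ha0 := hk.ne_zero_of_eq_coe hνa
  have haE0 : algebraMap k E a ≠ 0 := by simpa using ha0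
  have hax' : π ^ e = algebraMap k E a * x := by rw [hax]; field_simp
  set d := Nat.gcd ((qE - 1) / (q - 1)) e with hd
  have hdN : d ∣ (qE - 1) / (q - 1) := Nat.gcd_dvd_left _ _
  have hNmul : (qE - 1) = (q - 1) * ((qE - 1) / (q - 1)) := (Nat.mul_div_cancel' hqd).symm
  have hdN' : d ∣ qE - 1 := by rw [hNmul]; exact hdN.mul_left _
  have hde : d ∣ e := Nat.gcd_dvd_right _ _
  constructor
  · rintro ⟨-, π', hπ', a', ha', hay⟩
    have hνa' := hval y π' a' hy0 hπ' hay
    have ha0' := hk.ne_zero_of_eq_coe hνa'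
    have haE0' : algebraMap k E a' ≠ 0 := by simpa using ha0'
    have hay' : π' ^ e = algebraMap k E a' * y := by rw [hay]; field_simp
    obtain ⟨i, v, hiv, hv⟩ := hωu (π' * π⁻¹) (by
      rw [hE.map_mul, hπ', hE.map_inv hπ, ← EReal.coe_add]; simp)
    obtain ⟨j, v', hjv, hv'⟩ := hθu (a' * a⁻¹) (by
      rw [hk.map_mul, hνa', hk.map_inv hνa, ← EReal.coe_add]; simp)
    set t := algebraMap k E θ with ht
    have hv'E : 0 < νE (algebraMap k E v' - 1) := by
      rw [← hcompat] at hv'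
      simpa using hv'
    have hv0 := hE.ne_zero_of_map_eq_zero (hE.map_eq_zero_of_sub_one hv)
    have hω0 : ω ≠ 0 := hω.ne_zero hN0
    have ht0 : t ≠ 0 := hθE.ne_zero (by omega)
    have htN : t ^ (qE - 1) = 1 := by rw [hNmul, pow_mul, hθE.pow_eq_one, one_pow]
    have e1 : (ω ^ i) ^ e * v ^ e = algebraMap k E (a' * a⁻¹) * (y * x⁻¹) := by
      rw [← mul_pow, ← hiv, mul_pow, inv_pow, hax', hay', map_mul, map_inv₀]
      field_simp
    rw [hjv, map_mul, map_pow, ← ht] at e1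
    have e2 : (ω ^ i) ^ e * (x * y⁻¹) * (t ^ j)⁻¹ = algebraMap k E v' * (v ^ e)⁻¹ := by
      field_simp
      field_simp at e1
      linear_combination e1
    obtain ⟨l, -, hl⟩ := haveI : NeZero (qE - 1) := ⟨hN0⟩
      hω.eq_pow_of_pow_eq_one (ξ := (ω ^ i) ^ e * (x * y⁻¹) * (t ^ j)⁻¹) (by
        have h1 : ((ω ^ i) ^ e) ^ (qE - 1) = 1 := by
          rw [← pow_mul, ← pow_mul, ← mul_assoc, mul_comm, pow_mul, hω.pow_eq_one,
            one_pow]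
        have h2 : (t ^ j) ^ (qE - 1) = 1 := by
          rw [← pow_mul, mul_comm, pow_mul, htN, one_pow]
        simp [mul_pow, h1, h2, hx, hy])
    have hz : 0 < νE (ω ^ l - 1) := by
      rw [hl, e2]
      exact hE.sub_one_mul hv'E (hE.sub_one_inv (hE.sub_one_pow hv e))
    rw [(hω.pow_eq_one_iff_dvd l).2 (hωd l hz)] at hl
    have e3 : x * y⁻¹ = t ^ j * ((ω ^ i) ^ e)⁻¹ := by
      field_simp
      field_simp at hl
      linear_combination -hl
    have h1 : ((ω ^ i) ^ e) ^ ((qE - 1) / d) = 1 := by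
      obtain ⟨c, hc⟩ := hde
      rw [← pow_mul, ← pow_mul, show i * (e * ((qE - 1) / d)) = (qE - 1) * (i * c) by
        conv_lhs => rw [hc]
        conv_rhs => rw [← Nat.mul_div_cancel' hdN']
        ring, pow_mul, hω.pow_eq_one, one_pow]
    have h2 : (t ^ j) ^ ((qE - 1) / d) = 1 := by
      rw [← pow_mul, show j * ((qE - 1) / d) = (q - 1) * (j * ((qE - 1) / (q - 1) / d)) by
        conv_lhs => rw [hNmul, Nat.mul_div_assoc _ hdN]
        ring, pow_mul, hθE.pow_eq_one, one_pow]
    rw [e3, mul_pow, inv_pow, h1, h2]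
    simp
  · intro hxy
    refine ⟨hy, ?_⟩
    have hω0 : ω ≠ 0 := hω.ne_zero hN0
    obtain ⟨i, -, hi⟩ := haveI : NeZero (qE - 1) := ⟨hN0⟩
      hω.eq_pow_of_pow_eq_one (ξ := x * y⁻¹) (by simp [mul_pow, hx, hy])
    have hdi : d ∣ i := by
      rw [← hi, ← pow_mul, hω.pow_eq_one_iff_dvd] at hxy
      obtain ⟨c, hc⟩ := hdN'
      have hc0 : 0 < c := Nat.pos_of_ne_zero (by rintro rfl; omega)
      have hd0 : 0 < d := Nat.pos_of_ne_zero (by rintro h0; rw [h0] at hc; omega)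
      rw [hc, Nat.mul_div_cancel_left _ hd0] at hxy
      exact Nat.dvd_of_mul_dvd_mul_right hc0 hxy
    obtain ⟨j, hj⟩ := hdi
    have hbez := Nat.gcd_eq_gcd_ab ((qE - 1) / (q - 1)) e
    rw [← hd] at hbez
    set A := Nat.gcdA ((qE - 1) / (q - 1)) e
    set B := Nat.gcdB ((qE - 1) / (q - 1)) e
    set M := (qE - 1) / (q - 1) with hM
    have hωz : ω ^ (i : ℤ) = ((ω ^ (A * j)) ^ M) * ((ω ^ (B * j)) ^ e) := by
      rw [← zpow_natCast, ← zpow_natCast, ← zpow_mul, ← zpow_mul, ← zpow_add₀ hω0]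
      congr 1
      rw [hj]
      push_cast
      rw [hbez]
      ring
    obtain ⟨l, -, hl⟩ := haveI : NeZero (q - 1) := ⟨by omega⟩
      hθE.eq_pow_of_pow_eq_one (ξ := (ω ^ (A * j)) ^ M) (by
        rw [← pow_mul, mul_comm M, ← hNmul, ← zpow_natCast, ← zpow_mul, mul_comm, zpow_mul,
          zpow_natCast, hω.pow_eq_one, one_zpow])
    set η := ω ^ (B * j) with hη
    have hη1 : η ^ (qE - 1) = 1 := by
      rw [hη, ← zpow_natCast, ← zpow_mul, mul_comm, zpow_mul, zpow_natCast, hω.pow_eq_one,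
        one_zpow]
    have hη0 := hE.map_eq_zero_of_pow_eq_one hN0 hη1
    have hηne := hE.ne_zero_of_map_eq_zero hη0
    rw [zpow_natCast, hi, ← hl] at hωz
    have hθl : νk (θ ^ l) = 0 := hk.map_eq_zero_of_pow_eq_one (n := q - 1) (by omega) (by
      rw [← pow_mul, mul_comm, pow_mul, hθ.pow_eq_one, one_pow])
    refine ⟨π * η⁻¹, ?_, a * θ ^ l, ?_, ?_⟩
    · rw [hE.map_mul, hE.map_inv_of_eq_zero hη0, hπ, add_zero]
    · rw [hk.map_mul, hθl, add_zero]; exact ha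
    · rw [mul_pow, hax', map_mul, map_pow, inv_pow]
      field_simp
      field_simp at hωz
      linear_combination -hωz
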